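/- arXiv:1606.04816 — 2 statements merged into one kernel-verified Lean document; each statement's English description precedes it below -/
import Mathlib

section
/- For every natural number K > 2 there exists a natural number c with c ≤ K(K-1)/4 such that for all natural numbers n ≥ 1 and all r ∈ {1, 2, …, K!/2 − c}, for every preference profile π ∈ P^n and every linear order ≻₀ ∈ P, the profile π exhibits consensus of level r around ≻₀ if and only if π exhibits consensus of level 1 around ≻₀. -/
open Finset

/-- Preference relations on `K` alternatives, encoded as rankings, i.e. permutations
`σ` of `Fin K`: alternative `a` is preferred to `b` (`a ≻ b`) iff `σ a > σ b`.
These are in natural bijection with the `K!` linear orders on a `K`-element set. -/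
abbrev Pref (K : ℕ) := Equiv.Perm (Fin K)

/-- The inversion metric `d(≻,≻') = |≻ \ ≻'|`: the number of (unordered) pairs of
alternatives on which the two linear orders disagree. -/
def invDist {K : ℕ} (σ τ : Pref K) : ℕ :=
  (Finset.univ.filter fun p : Fin K × Fin K =>
    p.1 < p.2 ∧ ((σ p.1 < σ p.2) ↔ ¬ (τ p.1 < τ p.2))).card

/-- The reverse `⊽≻₀` of a preference relation `≻₀`: `a ⊽≻₀ b` iff `b ≻₀ a`. -/
def revPref {K : ℕ} (σ : Pref K) : Pref K := σ.trans Fin.revPerm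

/-- The Mahonian number `T(K,k)`: the number of permutations of `{1,…,K}` with
exactly `k` inversions. -/
def mahonian (K k : ℕ) : ℕ :=
  (Finset.univ.filter fun σ : Pref K => invDist σ (Equiv.refl (Fin K)) = k).card

/-- `c' = |{k ∈ ℕ : T(K,k) is odd}|`. -/
noncomputable def oddMahonianCount (K : ℕ) : ℕ := {k : ℕ | Odd (mahonian K k)}.ncard

/-- `P_k(≻₀) = {≻ ∈ P : d(≻,≻₀) = k}`. -/
def distSphere {K : ℕ} (σ₀ : Pref K) (k : ℕ) : Finset (Pref K) :=
  Finset.univ.filter fun σ => invDist σ σ₀ = k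

/-- `C ≥_{≻₀} C'` : `C` is at least as close to `≻₀` as `C'`. -/
def AtLeastAsClose {K : ℕ} (σ₀ : Pref K) (C C' : Finset (Pref K)) : Prop :=
  ∃ φ : Pref K → Pref K, Set.InjOn φ ↑C ∧ (∀ σ ∈ C, φ σ ∈ C') ∧
    ∀ σ ∈ C, invDist σ σ₀ ≤ invDist (φ σ) σ₀

/-- `C >_{≻₀} C'` : `C` is closer than `C'` to `≻₀`. -/
def Closer {K : ℕ} (σ₀ : Pref K) (C C' : Finset (Pref K)) : Prop :=
  ∃ φ : Pref K → Pref K, Set.InjOn φ ↑C ∧ (∀ σ ∈ C, φ σ ∈ C') ∧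
    (∀ σ ∈ C, invDist σ σ₀ ≤ invDist (φ σ) σ₀) ∧
    ∃ σ ∈ C, invDist σ σ₀ < invDist (φ σ) σ₀

/-- `μ_π(≻) = |{i : ≻ᵢ = ≻}|`. -/
def muRel {K n : ℕ} (π : Fin n → Pref K) (σ : Pref K) : ℕ :=
  (Finset.univ.filter fun i => π i = σ).card

/-- `μ_π(C) = |{i : ≻ᵢ ∈ C}|`. -/
def muSet {K n : ℕ} (π : Fin n → Pref K) (C : Finset (Pref K)) : ℕ :=
  (Finset.univ.filter fun i => π i ∈ C).card

/-- The profile `π` exhibits consensus of level `r` around `≻₀`. -/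
def ConsensusLevel {K n : ℕ} (π : Fin n → Pref K) (r : ℕ) (σ₀ : Pref K) : Prop :=
  (∀ C C' : Finset (Pref K), Disjoint C C' → C.card = r → C'.card = r →
      AtLeastAsClose σ₀ C C' → muSet π C' ≤ muSet π C) ∧
  (∃ C C' : Finset (Pref K), Disjoint C C' ∧ C.card = r ∧ C'.card = r ∧
      Closer σ₀ C C' ∧ muSet π C' < muSet π C)

/-- `(C₁, C₂)` is an `m`-balanced pair around `≻₀`. -/
def BalancedPair {K : ℕ} (σ₀ : Pref K) (m : ℕ) (C₁ C₂ : Finset (Pref K)) : Prop :=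
  Disjoint C₁ C₂ ∧ C₁.card = m ∧ C₂.card = m ∧
    ∀ k ≤ K * (K - 1) / 2,
      (C₁.filter fun σ => invDist σ σ₀ = k).card =
      (C₂.filter fun σ => invDist σ σ₀ = k).card

theorem invDist_eq_card {K : ℕ} (σ τ : Pref K) :
    invDist σ τ = #{p : Fin K × Fin K | σ p.1 < σ p.2 ∧ τ p.2 < τ p.1} := by
  have key : ∀ (ρ : Pref K) (a b : Fin K), a ≠ b → ρ a < ρ b ∨ ρ b < ρ a := fun ρ a b h =>
    lt_or_gt_of_ne (ρ.injective.ne h)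
  refine card_nbij' (fun p => if σ p.1 < σ p.2 then p else p.swap)
    (fun p => if p.1 < p.2 then p else p.swap) ?_ ?_ ?_ ?_
  · rintro ⟨a, b⟩ h
    simp only [coe_filter, mem_univ, true_and, Set.mem_ofPred_eq] at h ⊢
    have h1 := key σ a b h.1.ne
    have h2 := key τ a b h.1.ne
    split_ifs with hs <;> simp only [Prod.fst_swap, Prod.snd_swap] <;> grind
  · rintro ⟨a, b⟩ h
    simp only [coe_filter, mem_univ, true_and, Set.mem_ofPred_eq] at h ⊢
    have hne : a ≠ b := by rintro rfl; exact lt_irrefl _ h.1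
    have h1 := lt_or_gt_of_ne hne
    split_ifs with hs <;> simp only [Prod.fst_swap, Prod.snd_swap] <;> grind
  · rintro ⟨a, b⟩ h
    simp only [coe_filter, mem_univ, true_and, Set.mem_ofPred_eq] at h ⊢
    split_ifs <;> grind [Prod.fst_swap, Prod.snd_swap, Prod.swap_swap]
  · rintro ⟨a, b⟩ h
    simp only [coe_filter, mem_univ, true_and, Set.mem_ofPred_eq] at h ⊢
    have hne : a ≠ b := by rintro rfl; exact lt_irrefl _ h.1
    have h1 := lt_or_gt_of_ne hne
    split_ifs <;> grind [Prod.fst_swap, Prod.snd_swap, Prod.swap_swap]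

/-- Transposing two alternatives adjacent in `τ` that `σ` ranks as `τ` does creates exactly
one new inversion. -/
theorem invDist_mul_swap {K : ℕ} {σ τ : Pref K} {x y : Fin K}
    (hτ : (τ y : ℕ) = τ x + 1) (hσ : σ x < σ y) :
    invDist (σ * Equiv.swap x y) τ = invDist σ τ + 1 := by
  have hne : x ≠ y := by rintro rfl; exact lt_irrefl _ hσ
  rw [invDist_eq_card, invDist_eq_card]
  rw [← card_insert_of_notMem (a := (x, y))
    (s := {p : Fin K × Fin K | σ p.1 < σ p.2 ∧ τ p.2 < τ p.1})]
  swap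
  · simp only [mem_filter, mem_univ, true_and, not_and, not_lt]
    intro _
    rw [Fin.le_def]; omega
  refine card_equiv ((Equiv.swap x y).prodCongr (Equiv.swap x y)) ?_
  rintro ⟨a, b⟩
  simp only [mem_filter, mem_univ, true_and, mem_insert, Equiv.prodCongr_apply, Prod.map,
    Prod.mk.injEq, Equiv.Perm.mul_apply]
  have hv : ∀ c, (τ c : ℕ) = τ x ↔ c = x := fun c => by
    rw [← Fin.ext_iff, τ.injective.eq_iff]
  have hw : ∀ c, (τ c : ℕ) = τ y ↔ c = y := fun c => by
    rw [← Fin.ext_iff, τ.injective.eq_iff]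
  have h1 := hv a
  have h2 := hv b
  have h3 := hw a
  have h4 := hw b
  simp only [Equiv.swap_apply_def, Fin.lt_def] at *
  grind

theorem invDist_mul_swap_of_gt {K : ℕ} {σ τ : Pref K} {x y : Fin K}
    (hτ : (τ y : ℕ) = τ x + 1) (hσ : σ y < σ x) :
    invDist (σ * Equiv.swap x y) τ + 1 = invDist σ τ := by
  rw [← invDist_mul_swap (σ := σ * Equiv.swap x y) hτ (by simpa using hσ), mul_assoc,
    Equiv.swap_mul_self, mul_one]

theorem even_card_invDist_mod_three {K : ℕ} (hK : 2 < K) (τ : Pref K) (j : ℕ) :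
    Even #{σ : Pref K | invDist σ τ % 3 = j} := by
  obtain ⟨x, hx⟩ : ∃ x, (τ x : ℕ) = 0 := ⟨τ.symm ⟨0, by omega⟩, by simp⟩
  obtain ⟨y, hy⟩ : ∃ y, (τ y : ℕ) = 1 := ⟨τ.symm ⟨1, by omega⟩, by simp⟩
  obtain ⟨z, hz⟩ : ∃ z, (τ z : ℕ) = 2 := ⟨τ.symm ⟨2, by omega⟩, by simp⟩
  have hxy : x ≠ y := by rintro rfl; omega
  have hxz : x ≠ z := by rintro rfl; omega
  have hyz : y ≠ z := by rintro rfl; omega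
  have h1 : (τ y : ℕ) = τ x + 1 := by omega
  have h2 : (τ z : ℕ) = τ y + 1 := by omega
  set s := Equiv.swap x y with hs
  set t := Equiv.swap y z with ht
  have hss : s * s = 1 := Equiv.swap_mul_self _ _
  have htt : t * t = 1 := Equiv.swap_mul_self _ _
  have sx : s x = y := by simp [hs]
  have sy : s y = x := by simp [hs]
  have sz : s z = z := Equiv.swap_apply_of_ne_of_ne hxz.symm hyz.symm
  have tx : t x = x := Equiv.swap_apply_of_ne_of_ne hxy hxz
  have ty : t y = z := by simp [ht]
  have tz : t z = y := by simp [ht]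
  have us : ∀ σ : Pref K, σ x < σ y → invDist (σ * s) τ = invDist σ τ + 1 := fun σ h =>
    invDist_mul_swap h1 h
  have ut : ∀ σ : Pref K, σ y < σ z → invDist (σ * t) τ = invDist σ τ + 1 := fun σ h =>
    invDist_mul_swap h2 h
  have ds : ∀ σ : Pref K, σ y < σ x → invDist (σ * s) τ + 1 = invDist σ τ := fun σ h =>
    invDist_mul_swap_of_gt h1 h
  have dt : ∀ σ : Pref K, σ z < σ y → invDist (σ * t) τ + 1 = invDist σ τ := fun σ h =>
    invDist_mul_swap_of_gt h2 h
  let between (a b c : Fin K) (σ : Pref K) : Prop :=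
    (σ a < σ b ∧ σ b < σ c) ∨ (σ c < σ b ∧ σ b < σ a)
  have tri : ∀ σ : Pref K, between y x z σ ∨ between x y z σ ∨ between x z y σ := by
    intro σ
    have e1 := lt_or_gt_of_ne (σ.injective.ne hxy)
    have e2 := lt_or_gt_of_ne (σ.injective.ne hxz)
    have e3 := lt_or_gt_of_ne (σ.injective.ne hyz)
    simp only [between]
    grind
  have excl : ∀ σ : Pref K, (between x z y σ → ¬ between y x z σ ∧ ¬ between x y z σ) ∧
      (between x y z σ → ¬ between y x z σ) := by
    intro σ
    simp only [between]
    grind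
  have mid_x : ∀ σ : Pref K, between y x z σ →
      between x z y (σ * s * t) ∧ invDist (σ * s * t) τ = invDist σ τ := by
    intro σ h
    have e1 := us σ
    have e2 := ds σ
    have e3 := ut (σ * s)
    have e4 := dt (σ * s)
    simp only [between, Equiv.Perm.mul_apply, sx, sy, sz, tx, ty, tz] at *
    grind
  have mid_z : ∀ σ : Pref K, between x z y σ →
      between y x z (σ * t * s) ∧ invDist (σ * t * s) τ = invDist σ τ := by
    intro σ h
    have e1 := ut σ
    have e2 := dt σ
    have e3 := us (σ * t)
    have e4 := ds (σ * t)
    simp only [between, Equiv.Perm.mul_apply, sx, sy, sz, tx, ty, tz] at *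
    grind
  have mid_y : ∀ σ : Pref K, between x y z σ → between x y z (σ * s * t * s) ∧
      invDist (σ * s * t * s) τ % 3 = invDist σ τ % 3 := by
    intro σ h
    have e1 := us σ
    have e2 := ds σ
    have e3 := ut (σ * s)
    have e4 := dt (σ * s)
    have e5 := us (σ * s * t)
    have e6 := ds (σ * s * t)
    simp only [between, Equiv.Perm.mul_apply, sx, sy, sz, tx, ty, tz] at *
    grind
  classical
  let F : Pref K → Pref K := fun σ =>
    if between y x z σ then σ * s * t else if between x y z σ then σ * s * t * s else σ * t * s
  have F_invDist : ∀ σ, invDist (F σ) τ % 3 = invDist σ τ % 3 := by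
    intro σ
    simp only [F]
    grind
  have F_ne : ∀ σ, F σ ≠ σ := by
    intro σ h
    have hx := DFunLike.congr_fun h x
    have e1 := σ.injective.ne hxy
    have e2 := σ.injective.ne hxz
    simp only [F] at hx
    split_ifs at hx <;> simp only [Equiv.Perm.mul_apply, sx, sz, tx, ty] at hx <;> grind
  have cancel_s : ∀ σ : Pref K, σ * s * s = σ := fun σ => by rw [mul_assoc, hss, mul_one]
  have cancel_t : ∀ σ : Pref K, σ * t * t = σ := fun σ => by rw [mul_assoc, htt, mul_one]
  have F_F : ∀ σ, F (F σ) = σ := by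
    intro σ
    rcases tri σ with h | h | h
    · have h' := (mid_x σ h).1
      have e := (excl _).1 h'
      simp only [F, if_pos h, if_neg e.1, if_neg e.2, cancel_s, cancel_t]
    · have h' := (mid_y σ h).1
      simp only [F, if_neg ((excl _).2 h), if_neg ((excl _).2 h'), if_pos h, if_pos h', cancel_s,
        cancel_t]
    · have h' := (mid_z σ h).1
      have e := (excl _).1 h
      simp only [F, if_pos h', if_neg e.1, if_neg e.2, cancel_s, cancel_t]
  rw [← Nat.not_odd_iff_even, ← ZMod.natCast_ne_zero_iff_odd, not_not, card_eq_sum_ones,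
    Nat.cast_sum]
  refine sum_involution (fun σ _ => F σ) ?_ ?_ ?_ ?_
  · intros; decide
  · exact fun σ _ _ => F_ne σ
  · intro σ h
    rw [mem_filter] at h ⊢
    exact ⟨mem_univ _, (F_invDist σ).trans h.2⟩
  · exact fun σ _ => F_F σ

theorem card_filter_range_mod_three (m : ℕ) {j : ℕ} (hj : j < 3) :
    #{k ∈ range m | k % 3 = j} = (m + 2 - j) / 3 := by
  induction m with
  | zero => simp; omega
  | succ m ih =>
    rw [range_add_one, filter_insert]
    split_ifs with h
    · rw [card_insert_of_notMem (by simp), ih]; omega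
    · rw [ih]; omega

theorem card_pairs_lt (K : ℕ) :
    #{p : Fin K × Fin K | p.1 < p.2} = K * (K - 1) / 2 := by
  have h1 : #{p : Fin K × Fin K | p.2 < p.1} = #{p : Fin K × Fin K | p.1 < p.2} :=
    card_equiv (Equiv.prodComm _ _) (by simp)
  have h2 : #{p : Fin K × Fin K | p.1 < p.2} + #{p : Fin K × Fin K | p.2 < p.1} =
      #(univ : Finset (Fin K)).offDiag := by
    rw [← card_union_of_disjoint]
    · congr 1
      ext p
      simp [lt_or_lt_iff_ne]
    · rw [disjoint_filter]
      exact fun p _ h => h.asymm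
  rw [offDiag_card, card_univ, Fintype.card_fin, ← Nat.mul_sub_one] at h2
  omega

theorem invDist_le {K : ℕ} (σ τ : Pref K) : invDist σ τ ≤ K * (K - 1) / 2 := by
  rw [← card_pairs_lt]
  exact card_le_card fun p hp => by simp_all

theorem exists_even_card_sphere {K : ℕ} (hK : 2 < K) (τ : Pref K) :
    ∃ k ∈ range (K * (K - 1) / 2 + 1), Even #{σ : Pref K | invDist σ τ = k} := by
  by_contra! hcon
  simp only [Nat.not_even_iff_odd] at hcon
  have hN : (K * (K - 1) / 2) % 3 ≠ 2 := by
    obtain ⟨m, hm⟩ := Nat.even_mul_pred_self K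
    have h := Nat.mul_mod K (K - 1) 3
    have h3 : K % 3 = 0 ∧ (K - 1) % 3 = 2 ∨ K % 3 = 1 ∧ (K - 1) % 3 = 0 ∨
      K % 3 = 2 ∧ (K - 1) % 3 = 1 := by omega
    rcases h3 with h3 | h3 | h3 <;> rw [h3.1, h3.2] at h <;> omega
  have key : ∀ j < 3, Even ((K * (K - 1) / 2 + 1 + 2 - j) / 3) := by
    intro j hj
    have h := even_card_invDist_mod_three hK τ j
    rw [card_eq_sum_card_fiberwise (f := fun σ => invDist σ τ)
      (t := {k ∈ range (K * (K - 1) / 2 + 1) | k % 3 = j})] at h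
    · rw [even_sum_iff_even_card_odd, filter_true_of_mem, card_filter_range_mod_three _ hj] at h
      · exact h
      · intro k hk
        rw [mem_filter] at hk
        convert hcon k hk.1 using 2
        ext σ
        simp only [mem_filter, mem_univ, true_and, and_iff_right_iff_imp]
        rintro rfl
        exact hk.2
    · intro σ hσ
      have := invDist_le σ τ
      simp only [coe_filter, mem_univ, true_and, Set.mem_ofPred_eq, mem_range] at hσ ⊢
      omega
  obtain ⟨a, ha⟩ := key 0 (by omega)
  obtain ⟨b, hb⟩ := key 1 (by omega)
  obtain ⟨c, hc⟩ := key 2 (by omega)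
  omega

theorem AtLeastAsClose.insert {K : ℕ} {σ₀ : Pref K} {C C' : Finset (Pref K)} {a b : Pref K}
    (h : AtLeastAsClose σ₀ C C') (hb : b ∉ C')
    (hab : invDist a σ₀ ≤ invDist b σ₀) :
    AtLeastAsClose σ₀ (insert a C) (insert b C') := by
  obtain ⟨φ, hinj, hmap, hle⟩ := h
  refine ⟨Function.update φ a b, ?_, ?_, ?_⟩
  · intro u hu v hv huv
    simp only [coe_insert, Set.mem_insert_iff, mem_coe] at hu hv
    have := @hinj u
    simp only [Function.update_apply] at huv
    grind
  · intro u hu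
    simp only [Function.update_apply]
    grind
  · intro u hu
    simp only [Function.update_apply]
    grind

theorem Closer.insert {K : ℕ} {σ₀ : Pref K} {C C' : Finset (Pref K)} {a b : Pref K}
    (h : AtLeastAsClose σ₀ C C') (hb : b ∉ C')
    (hab : invDist a σ₀ < invDist b σ₀) :
    Closer σ₀ (insert a C) (insert b C') := by
  obtain ⟨φ, hinj, hmap, hle⟩ := h
  refine ⟨Function.update φ a b, ?_, ?_, ?_, a, mem_insert_self _ _, by simpa using hab⟩
  · intro u hu v hv huv
    simp only [coe_insert, Set.mem_insert_iff, mem_coe] at hu hv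
    have := @hinj u
    simp only [Function.update_apply] at huv
    grind
  · intro u hu
    simp only [Function.update_apply]
    grind
  · intro u hu
    simp only [Function.update_apply]
    grind

/-- The number of disjoint pairs of equidistant rankings that can be formed within `X`. -/
def pairCapacity {K : ℕ} (σ₀ : Pref K) (X : Finset (Pref K)) : ℕ :=
  ∑ k ∈ range (K * (K - 1) / 2 + 1), #{σ ∈ X | invDist σ σ₀ = k} / 2

theorem card_filter_erase {K : ℕ} (σ₀ : Pref K) {X : Finset (Pref K)} {a : Pref K} (ha : a ∈ X)
    (k : ℕ) :
    #{σ ∈ X.erase a | invDist σ σ₀ = k} =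
      #{σ ∈ X | invDist σ σ₀ = k} - if invDist a σ₀ = k then 1 else 0 := by
  rw [filter_erase]
  split_ifs with h
  · exact card_erase_of_mem (by simp [ha, h])
  · rw [erase_eq_of_notMem (by simp [h]), Nat.sub_zero]

theorem pairCapacity_le_erase_add_one {K : ℕ} (σ₀ : Pref K) {X : Finset (Pref K)} {a : Pref K}
    (ha : a ∈ X) : pairCapacity σ₀ X ≤ pairCapacity σ₀ (X.erase a) + 1 := by
  calc pairCapacity σ₀ X
      ≤ ∑ k ∈ range (K * (K - 1) / 2 + 1), (#{σ ∈ X.erase a | invDist σ σ₀ = k} / 2 +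
          if invDist a σ₀ = k then 1 else 0) := by
        refine sum_le_sum fun k _ => ?_
        rw [card_filter_erase σ₀ ha]
        split_ifs <;> omega
    _ ≤ _ := by
        rw [sum_add_distrib, sum_ite_eq]
        unfold pairCapacity
        split_ifs <;> omega

theorem pairCapacity_le_erase_of_odd {K : ℕ} (σ₀ : Pref K) {X : Finset (Pref K)} {a : Pref K}
    (ha : a ∈ X) (h : Odd #{σ ∈ X | invDist σ σ₀ = invDist a σ₀}) :
    pairCapacity σ₀ X ≤ pairCapacity σ₀ (X.erase a) := by
  refine sum_le_sum fun k _ => ?_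
  rw [card_filter_erase σ₀ ha]
  obtain ⟨m, hm⟩ := h
  split_ifs with hk
  · subst hk; omega
  · simp

theorem pairCapacity_le_erase_erase_add_one {K : ℕ} (σ₀ : Pref K) {X : Finset (Pref K)}
    {a b : Pref K} (ha : a ∈ X) (hb : b ∈ X) (hab : a ≠ b)
    (h : invDist a σ₀ = invDist b σ₀ ∨ Odd #{σ ∈ X | invDist σ σ₀ = invDist a σ₀}) :
    pairCapacity σ₀ X ≤ pairCapacity σ₀ ((X.erase a).erase b) + 1 := by
  have hb' : b ∈ X.erase a := mem_erase.2 ⟨hab.symm, hb⟩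
  by_cases ho : Odd #{σ ∈ X | invDist σ σ₀ = invDist a σ₀}
  · exact (pairCapacity_le_erase_of_odd σ₀ ha ho).trans (pairCapacity_le_erase_add_one σ₀ hb')
  · have h := h.resolve_right ho
    refine (pairCapacity_le_erase_add_one σ₀ ha).trans (Nat.add_le_add_right ?_ 1)
    refine pairCapacity_le_erase_of_odd σ₀ hb' ?_
    rw [card_filter_erase σ₀ ha, if_pos h, ← h]
    rw [Nat.not_odd_iff_even] at ho
    refine Nat.Even.sub_odd (card_pos.2 ⟨a, by simp [ha]⟩) ho odd_one

theorem exists_balanced {K : ℕ} (σ₀ : Pref K) (m : ℕ) (X : Finset (Pref K))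
    (hm : m ≤ pairCapacity σ₀ X) :
    ∃ C C' : Finset (Pref K), C ⊆ X ∧ C' ⊆ X ∧ Disjoint C C' ∧ #C = m ∧ #C' = m ∧
      AtLeastAsClose σ₀ C C' ∧ AtLeastAsClose σ₀ C' C := by
  induction m generalizing X with
  | zero => exact ⟨∅, ∅, by simp, by simp, by simp, by simp, by simp, ⟨id, by simp⟩, ⟨id, by simp⟩⟩
  | succ m ih =>
    obtain ⟨k, -, hk⟩ : ∃ k ∈ range (K * (K - 1) / 2 + 1),
        #{σ ∈ X | invDist σ σ₀ = k} / 2 ≠ 0 := by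
      by_contra! hcon
      have : pairCapacity σ₀ X = 0 := sum_eq_zero hcon
      omega
    obtain ⟨a, ha, b, hb, hab⟩ := one_lt_card.1 (show 1 < #{σ ∈ X | invDist σ σ₀ = k} by omega)
    rw [mem_filter] at ha hb
    have hd : invDist a σ₀ = invDist b σ₀ := ha.2.trans hb.2.symm
    have hcap := pairCapacity_le_erase_erase_add_one σ₀ ha.1 hb.1 hab (Or.inl hd)
    obtain ⟨C, C', hC, hC', hdis, hc, hc', h1, h2⟩ := ih ((X.erase a).erase b) (by omega)
    have haC : a ∉ C := fun h => by simpa using hC h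
    have hbC : b ∉ C := fun h => by simpa using hC h
    have haC' : a ∉ C' := fun h => by simpa using hC' h
    have hbC' : b ∉ C' := fun h => by simpa using hC' h
    have hX : (X.erase a).erase b ⊆ X := (erase_subset _ _).trans (erase_subset _ _)
    refine ⟨insert a C, insert b C', insert_subset ha.1 (hC.trans hX),
      insert_subset hb.1 (hC'.trans hX), ?_, by rw [card_insert_of_notMem haC, hc],
      by rw [card_insert_of_notMem hbC', hc'], h1.insert hbC' hd.le, h2.insert haC hd.ge⟩
    simp only [disjoint_insert_left, disjoint_insert_right, mem_insert]
    tauto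

theorem muSet_eq_sum {K n : ℕ} (π : Fin n → Pref K) (C : Finset (Pref K)) :
    muSet π C = ∑ σ ∈ C, muRel π σ := by
  unfold muSet muRel
  rw [card_eq_sum_card_fiberwise (f := π) (t := C) (fun i hi => by simpa using hi)]
  refine sum_congr rfl fun σ hσ => ?_
  rw [filter_filter]
  congr 1
  ext i
  simp only [mem_filter, mem_univ, true_and, and_iff_right_iff_imp]
  rintro rfl
  exact hσ

theorem muSet_insert {K n : ℕ} (π : Fin n → Pref K) {C : Finset (Pref K)} {a : Pref K}
    (ha : a ∉ C) : muSet π (insert a C) = muRel π a + muSet π C := by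
  simp only [muSet_eq_sum, sum_insert ha]

/-- Rankings closer to `σ₀` are at least as frequent in `π`. -/
def MonotoneAround {K n : ℕ} (π : Fin n → Pref K) (σ₀ : Pref K) : Prop :=
  ∀ a b : Pref K, invDist a σ₀ ≤ invDist b σ₀ → muRel π b ≤ muRel π a

theorem image_eq_of_card_eq {K r : ℕ} {C C' : Finset (Pref K)} {φ : Pref K → Pref K}
    (hinj : Set.InjOn φ ↑C) (hmap : ∀ σ ∈ C, φ σ ∈ C') (hC : #C = r) (hC' : #C' = r) :
    C.image φ = C' :=
  eq_of_subset_of_card_le (image_subset_iff.2 hmap) (by rw [card_image_of_injOn hinj, hC, hC'])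

theorem MonotoneAround.muSet_le {K n r : ℕ} {π : Fin n → Pref K} {σ₀ : Pref K}
    (h : MonotoneAround π σ₀) {C C' : Finset (Pref K)} (hC : #C = r) (hC' : #C' = r)
    (hCC' : AtLeastAsClose σ₀ C C') : muSet π C' ≤ muSet π C := by
  obtain ⟨φ, hinj, hmap, hle⟩ := hCC'
  rw [← image_eq_of_card_eq hinj hmap hC hC', muSet_eq_sum, muSet_eq_sum, sum_image hinj]
  exact sum_le_sum fun σ hσ => h _ _ (hle σ hσ)

/-- Two distinct rankings extend to disjoint sets of size `r` by balanced pairs, possibly after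
first adjoining to each of them an equidistant companion. -/
theorem exists_balanced_avoiding {K r : ℕ} {σ₀ : Pref K} (hr : r + 1 ≤ pairCapacity σ₀ univ)
    {a b : Pref K} (hab : a ≠ b) :
    (∃ C C' : Finset (Pref K), (a ∉ C ∧ b ∉ C ∧ a ∉ C' ∧ b ∉ C') ∧ Disjoint C C' ∧
      #C = r ∧ #C' = r ∧ AtLeastAsClose σ₀ C C' ∧ AtLeastAsClose σ₀ C' C) ∨
    (invDist a σ₀ ≠ invDist b σ₀ ∧
      ∃ a' b' : Pref K, invDist a' σ₀ = invDist a σ₀ ∧ invDist b' σ₀ = invDist b σ₀ ∧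
        a' ≠ a ∧ b' ≠ b ∧ ∃ s, r = s + 1 ∧ ∃ C C' : Finset (Pref K),
          (a ∉ C ∧ b ∉ C ∧ a' ∉ C ∧ b' ∉ C) ∧ (a ∉ C' ∧ b ∉ C' ∧ a' ∉ C' ∧ b' ∉ C') ∧
          Disjoint C C' ∧ #C = s ∧ #C' = s ∧
          AtLeastAsClose σ₀ C C' ∧ AtLeastAsClose σ₀ C' C) := by
  by_cases hcap : r ≤ pairCapacity σ₀ ((univ.erase a).erase b)
  · left
    obtain ⟨C, C', hC, hC', h⟩ := exists_balanced σ₀ r _ hcap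
    exact ⟨C, C', ⟨fun h => by simpa using hC h, fun h => by simpa using hC h,
      fun h => by simpa using hC' h, fun h => by simpa using hC' h⟩, h⟩
  right
  have companion : ∀ c : Pref K, ¬ Odd #{σ : Pref K | invDist σ σ₀ = invDist c σ₀} →
      ∃ c', invDist c' σ₀ = invDist c σ₀ ∧ c' ≠ c := by
    intro c hc
    have hmem : c ∈ ({σ : Pref K | invDist σ σ₀ = invDist c σ₀} : Finset _) := by simp
    have hpos := card_pos.2 ⟨c, hmem⟩
    have : 1 < #{σ : Pref K | invDist σ σ₀ = invDist c σ₀} := by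
      rw [Nat.not_odd_iff_even] at hc
      obtain ⟨m, hm⟩ := hc
      omega
    obtain ⟨c', hc', hne⟩ := exists_mem_ne this c
    exact ⟨c', by simpa using hc', hne⟩
  have hpair := fun h => pairCapacity_le_erase_erase_add_one σ₀ (mem_univ a) (mem_univ b) hab h
  have hpair' := fun h =>
    pairCapacity_le_erase_erase_add_one σ₀ (mem_univ b) (mem_univ a) hab.symm h
  rw [erase_right_comm] at hpair'
  have hne : invDist a σ₀ ≠ invDist b σ₀ := fun h => by have := hpair (Or.inl h); omega
  obtain ⟨a', ha', haa'⟩ := companion a fun h => by have := hpair (Or.inr h); omega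
  obtain ⟨b', hb', hbb'⟩ := companion b fun h => by have := hpair' (Or.inr h); omega
  refine ⟨hne, a', b', ha', hb', haa', hbb', r - 1, by omega, ?_⟩
  have hba : b ≠ a' := by rintro rfl; exact hne ha'.symm
  have hb'a : b' ≠ a := by rintro rfl; exact hne hb'
  have hb'a' : b' ≠ a' := by rintro rfl; exact hne (ha'.symm.trans hb')
  have c1 := pairCapacity_le_erase_erase_add_one σ₀ (mem_univ a) (mem_univ a') haa'.symm
    (Or.inl ha'.symm)
  have c2 := pairCapacity_le_erase_erase_add_one σ₀ (X := (univ.erase a).erase a') (a := b)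
    (b := b') (by simp [hba, hab.symm]) (by simp [hb'a, hb'a']) hbb'.symm (Or.inl hb'.symm)
  obtain ⟨C, C', hC, hC', h⟩ := exists_balanced σ₀ (r - 1) _
    (show r - 1 ≤ pairCapacity σ₀ ((((univ.erase a).erase a').erase b).erase b') by omega)
  exact ⟨C, C', ⟨fun h => by simpa using hC h, fun h => by simpa using hC h,
    fun h => by simpa using hC h, fun h => by simpa using hC h⟩,
    ⟨fun h => by simpa using hC' h, fun h => by simpa using hC' h,
    fun h => by simpa using hC' h, fun h => by simpa using hC' h⟩, h⟩

theorem ConsensusLevel.monotoneAround {K n r : ℕ} {π : Fin n → Pref K} {σ₀ : Pref K}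
    (hr : r + 1 ≤ pairCapacity σ₀ univ) (h : ConsensusLevel π (r + 1) σ₀) :
    MonotoneAround π σ₀ := by
  have adjoin : ∀ a b : Pref K, a ≠ b → invDist a σ₀ ≤ invDist b σ₀ →
      (∃ C C' : Finset (Pref K), (a ∉ C ∧ b ∉ C ∧ a ∉ C' ∧ b ∉ C') ∧ Disjoint C C' ∧
      #C = r ∧ #C' = r ∧ AtLeastAsClose σ₀ C C' ∧ AtLeastAsClose σ₀ C' C) →
      muRel π b ≤ muRel π a := by
    rintro a b hab hd ⟨C, C', ⟨h1, h2, h3, h4⟩, hdis, hc, hc', h5, h6⟩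
    have e1 := h.1 (insert a C) (insert b C')
      (by simp only [disjoint_insert_left, disjoint_insert_right, mem_insert]; tauto)
      (by rw [card_insert_of_notMem h1, hc]) (by rw [card_insert_of_notMem h4, hc'])
      (h5.insert h4 hd)
    have e2 := h.1 (insert a C') (insert b C)
      (by simp only [disjoint_insert_right, mem_insert, disjoint_comm]; tauto)
      (by rw [card_insert_of_notMem h3, hc']) (by rw [card_insert_of_notMem h2, hc])
      (h6.insert h2 hd)
    rw [muSet_insert π h1, muSet_insert π h4] at e1
    rw [muSet_insert π h3, muSet_insert π h2] at e2
    omega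
  have same : ∀ a b : Pref K, a ≠ b → invDist a σ₀ = invDist b σ₀ → muRel π b = muRel π a := by
    intro a b hab hd
    exact le_antisymm
      (adjoin a b hab hd.le ((exists_balanced_avoiding hr hab).resolve_right fun h => h.1 hd))
      (adjoin b a hab.symm hd.ge
        ((exists_balanced_avoiding hr hab.symm).resolve_right fun h => h.1 hd.symm))
  intro a b hd
  rcases eq_or_ne a b with rfl | hab
  · rfl
  rcases exists_balanced_avoiding hr hab with hC |
    ⟨hne, a', b', ha', hb', haa', hbb', s, rfl, C, C', ⟨h1, h2, h3, h4⟩, ⟨h5, h6, h7, h8⟩,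
      hdis, hc, hc', h9, h10⟩
  · exact adjoin a b hab hd hC
  have hba : b ≠ a' := by rintro rfl; exact hne ha'.symm
  have hb'a : b' ≠ a := by rintro rfl; exact hne hb'
  have hb'a' : b' ≠ a' := by rintro rfl; exact hne (ha'.symm.trans hb')
  have h3' : a ∉ insert a' C := by simp [h1, haa'.symm]
  have h8' : b ∉ insert b' C' := by simp [h6, hbb'.symm]
  have h5' : a ∉ insert a' C' := by simp [h5, haa'.symm]
  have h2' : b ∉ insert b' C := by simp [h2, hbb'.symm]
  have hd' : invDist a' σ₀ ≤ invDist b' σ₀ := by rw [ha', hb']; exact hd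
  have e1 := h.1 (insert a (insert a' C)) (insert b (insert b' C'))
    (by simp only [disjoint_insert_left, disjoint_insert_right, mem_insert]; grind)
    (by rw [card_insert_of_notMem h3', card_insert_of_notMem h3, hc])
    (by rw [card_insert_of_notMem h8', card_insert_of_notMem h8, hc'])
    ((h9.insert h8 hd').insert h8' hd)
  have e2 := h.1 (insert a (insert a' C')) (insert b (insert b' C))
    (by simp only [disjoint_insert_left, disjoint_insert_right, mem_insert]; grind)
    (by rw [card_insert_of_notMem h5', card_insert_of_notMem h7, hc'])
    (by rw [card_insert_of_notMem h2', card_insert_of_notMem h4, hc])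
    ((h10.insert h4 hd').insert h2' hd)
  rw [muSet_insert π h3', muSet_insert π h3, muSet_insert π h8', muSet_insert π h8] at e1
  rw [muSet_insert π h5', muSet_insert π h7, muSet_insert π h2', muSet_insert π h4] at e2
  have s1 := same a a' haa'.symm ha'.symm
  have s2 := same b b' hbb'.symm hb'.symm
  omega

theorem consensusLevel_iff {K n r : ℕ} {π : Fin n → Pref K} {σ₀ : Pref K}
    (hr : r + 1 ≤ pairCapacity σ₀ univ) :
    ConsensusLevel π (r + 1) σ₀ ↔ MonotoneAround π σ₀ ∧
      ∃ a b : Pref K, invDist a σ₀ < invDist b σ₀ ∧ muRel π b < muRel π a := by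
  constructor
  · intro h
    have hmono := h.monotoneAround hr
    refine ⟨hmono, ?_⟩
    obtain ⟨C, C', -, hc, hc', ⟨φ, hinj, hmap, hle, -⟩, hlt⟩ := h.2
    rw [← image_eq_of_card_eq hinj hmap hc hc', muSet_eq_sum, muSet_eq_sum, sum_image hinj] at hlt
    obtain ⟨σ, hσ, hσlt⟩ := exists_lt_of_sum_lt hlt
    refine ⟨σ, φ σ, lt_of_le_of_ne (hle σ hσ) fun heq => ?_, hσlt⟩
    exact hσlt.not_ge (hmono _ _ heq.ge)
  · rintro ⟨hmono, a, b, hd, hμ⟩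
    refine ⟨fun C C' _ hc hc' hCC' => hmono.muSet_le hc hc' hCC', ?_⟩
    have hab : a ≠ b := by rintro rfl; exact lt_irrefl _ hd
    rcases exists_balanced_avoiding hr hab with
      ⟨C, C', ⟨h1, h2, h3, h4⟩, hdis, hc, hc', h5, h6⟩ |
      ⟨hne, a', b', ha', hb', haa', hbb', s, rfl, C, C', ⟨h1, h2, h3, h4⟩, ⟨h5, h6, h7, h8⟩,
        hdis, hc, hc', h9, h10⟩
    · refine ⟨insert a C, insert b C',
        by simp only [disjoint_insert_left, disjoint_insert_right, mem_insert]; tauto,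
        by rw [card_insert_of_notMem h1, hc], by rw [card_insert_of_notMem h4, hc'],
        Closer.insert h5 h4 hd, ?_⟩
      rw [muSet_insert π h1, muSet_insert π h4]
      have := hmono.muSet_le hc hc' h5
      omega
    · have hba : b ≠ a' := by rintro rfl; exact hne ha'.symm
      have hb'a : b' ≠ a := by rintro rfl; exact hne hb'
      have hb'a' : b' ≠ a' := by rintro rfl; exact hne (ha'.symm.trans hb')
      have h3' : a ∉ insert a' C := by simp [h1, haa'.symm]
      have h8' : b ∉ insert b' C' := by simp [h6, hbb'.symm]
      have hd' : invDist a' σ₀ ≤ invDist b' σ₀ := by rw [ha', hb']; exact hd.le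
      refine ⟨insert a (insert a' C), insert b (insert b' C'),
        by simp only [disjoint_insert_left, disjoint_insert_right, mem_insert]; grind,
        by rw [card_insert_of_notMem h3', card_insert_of_notMem h3, hc],
        by rw [card_insert_of_notMem h8', card_insert_of_notMem h8, hc'],
        Closer.insert (h9.insert h8 hd') h8' hd, ?_⟩
      rw [muSet_insert π h3', muSet_insert π h3, muSet_insert π h8', muSet_insert π h8]
      have := hmono.muSet_le hc hc' h9
      have := hmono a' b' hd'
      omega

theorem le_pairCapacity_univ {K : ℕ} (hK : 2 < K) (σ₀ : Pref K) :
    K.factorial / 2 - K * (K - 1) / 4 ≤ pairCapacity σ₀ univ := by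
  obtain ⟨k₀, hk₀, heven⟩ := exists_even_card_sphere hK σ₀
  have htotal : K.factorial =
      ∑ k ∈ range (K * (K - 1) / 2 + 1), #{σ : Pref K | invDist σ σ₀ = k} := by
    rw [← card_eq_sum_card_fiberwise (f := fun σ => invDist σ σ₀)
      (fun σ _ => by simpa [Nat.lt_succ_iff] using invDist_le σ σ₀), card_univ,
      Fintype.card_perm, Fintype.card_fin]
  have hsplit : K.factorial = 2 * pairCapacity σ₀ univ +
      ∑ k ∈ range (K * (K - 1) / 2 + 1), #{σ : Pref K | invDist σ σ₀ = k} % 2 := by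
    rw [htotal, pairCapacity, mul_sum, ← sum_add_distrib]
    exact sum_congr rfl fun k _ => (Nat.div_add_mod _ 2).symm
  have hodd : ∑ k ∈ range (K * (K - 1) / 2 + 1), #{σ : Pref K | invDist σ σ₀ = k} % 2 <
      ∑ _k ∈ range (K * (K - 1) / 2 + 1), 1 :=
    sum_lt_sum (fun k _ => by omega) ⟨k₀, hk₀, by rw [Nat.even_iff.1 heven]; omega⟩
  rw [sum_const, card_range, smul_eq_mul, mul_one] at hodd
  have := Nat.div_div_eq_div_mul (K * (K - 1)) 2 2
  omega

/-- the hierarchy of level `r` consensus collapses up to level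
`K!/2 - c` for some `c ≤ K(K-1)/4`. -/
theorem stmt0 :
    ∀ K : ℕ, 2 < K → ∃ c : ℕ, c ≤ K * (K - 1) / 4 ∧
      ∀ n : ℕ, 1 ≤ n → ∀ r : ℕ, 1 ≤ r → r ≤ K.factorial / 2 - c →
        ∀ π : Fin n → Pref K, ∀ σ₀ : Pref K,
          (ConsensusLevel π r σ₀ ↔ ConsensusLevel π 1 σ₀) := by
  intro K hK
  refine ⟨K * (K - 1) / 4, le_rfl, fun n _ r hr hrK π σ₀ => ?_⟩
  have hcap := hrK.trans (le_pairCapacity_univ hK σ₀)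
  obtain ⟨r, rfl⟩ := Nat.exists_eq_add_of_le' hr
  rw [consensusLevel_iff hcap]
  exact (consensusLevel_iff (r := 0) (by omega)).symm
end

section
/- Let K > 2, let ≻₀ ∈ P, let c = c'/2 where c' = |{k ∈ ℕ : T(K,k) is odd}|, and let ⊽≻₀ denote the reverse of ≻₀. For all distinct preference relations ≻₁, ≻₂ ∈ P \ {≻₀, ⊽≻₀}, there exists a (K!/2 − c)-balanced pair (C₁, C₂) around ≻₀ such that ≻₁ ∈ C₁ and ≻₂ ∈ C₂. -/
open Finset

/-- A finset splits into two disjoint halves (up to one element) separating two prescribed points. -/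
theorem Finset.exists_disjoint_halves {α : Type*} [DecidableEq α] (S : Finset α) {a b : α}
    (hab : a ≠ b) (ha : a ∈ S → 2 ≤ S.card) (hb : b ∈ S → 2 ≤ S.card) :
    ∃ A B : Finset α, A ⊆ S ∧ B ⊆ S ∧ Disjoint A B ∧ A.card = S.card / 2 ∧ B.card = S.card / 2 ∧
      (a ∈ S → a ∈ A) ∧ (b ∈ S → b ∈ B) := by
  have key : ∀ x, (x ∈ S → 2 ≤ S.card) → (S ∩ {x}).card ≤ S.card / 2 := by
    intro x hx
    by_cases h : x ∈ S
    · have := hx h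
      rw [inter_singleton_of_mem h, card_singleton]
      omega
    · simp [inter_singleton_of_notMem h]
  obtain ⟨A, haA, hAS, hA⟩ : ∃ A, S ∩ {a} ⊆ A ∧ A ⊆ S \ {b} ∧ A.card = S.card / 2 := by
    refine exists_subsuperset_card_eq ?_ (key a ha) ?_
    · intro x hx
      simp only [mem_inter, mem_singleton, mem_sdiff] at hx ⊢
      exact ⟨hx.1, hx.2 ▸ hab⟩
    · have h₁ := card_sdiff_add_card_inter S {b}
      have h₂ := key b hb
      omega
  obtain ⟨B, hbB, hBS, hB⟩ : ∃ B, S ∩ {b} ⊆ B ∧ B ⊆ S \ A ∧ B.card = S.card / 2 := by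
    refine exists_subsuperset_card_eq ?_ (key b hb) ?_
    · intro x hx
      simp only [mem_inter, mem_singleton] at hx
      refine mem_sdiff.2 ⟨hx.1, fun hxA => ?_⟩
      simpa [hx.2] using hAS hxA
    · rw [card_sdiff_of_subset (hAS.trans sdiff_subset), hA]
      omega
  refine ⟨A, B, hAS.trans sdiff_subset, hBS.trans sdiff_subset, ?_, hA, hB,
    fun h => haA (by simp [h]), fun h => hbB (by simp [h])⟩
  exact disjoint_of_subset_right hBS disjoint_sdiff

/-- Twice the sum of the halved fibre sizes, plus the number of odd fibres, is the size of the
domain. -/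
theorem card_eq_two_mul_sum_card_fiber_half {α β : Type*} [Fintype α] [DecidableEq β] (f : α → β) :
    Fintype.card α = 2 * ∑ k ∈ univ.image f, (univ.filter fun x => f x = k).card / 2 +
      {k | Odd (univ.filter fun x => f x = k).card}.ncard := by
  have hodd : {k | Odd (univ.filter fun x => f x = k).card} =
      ↑((univ.image f).filter fun k => Odd (univ.filter fun x => f x = k).card) := by
    ext k
    simp only [Set.mem_ofPred_eq, coe_filter, mem_image, mem_univ, true_and]
    refine ⟨fun h => ⟨?_, h⟩, fun h => h.2⟩
    obtain ⟨x, hx⟩ := card_pos.1 h.pos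
    exact ⟨x, by simpa using hx⟩
  rw [hodd, Set.ncard_coe_finset, card_filter, mul_sum, ← sum_add_distrib, ← card_univ,
    card_eq_sum_card_image f]
  refine sum_congr rfl fun k _ => ?_
  split_ifs with h
  · rw [Nat.odd_iff] at h
    omega
  · rw [Nat.not_odd_iff] at h
    omega

/-- Two points lying in non-singleton fibres of `f` are separated by two disjoint sets, each of
which takes half (rounded down) of every fibre. -/
theorem exists_disjoint_fiberwise_halves {α β : Type*} [Fintype α] [DecidableEq α] [DecidableEq β]
    (f : α → β) {a b : α} (hab : a ≠ b) (ha : ∃ x ≠ a, f x = f a) (hb : ∃ x ≠ b, f x = f b) :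
    ∃ A B : Finset α, Disjoint A B ∧
      (∀ k, (A.filter fun x => f x = k).card = (univ.filter fun x => f x = k).card / 2) ∧
      (∀ k, (B.filter fun x => f x = k).card = (univ.filter fun x => f x = k).card / 2) ∧
      a ∈ A ∧ b ∈ B := by
  have two : ∀ y, (∃ x ≠ y, f x = f y) → ∀ k, y ∈ (univ.filter fun x => f x = k) →
      2 ≤ (univ.filter fun x => f x = k).card := by
    rintro y ⟨x, hxy, hx⟩ k hy
    simp only [mem_filter, mem_univ, true_and] at hy
    exact one_lt_card.2 ⟨x, by simp [hx, hy], y, by simp [hy], hxy⟩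
  choose A B hA hB hAB hAc hBc haA hbB using fun k =>
    exists_disjoint_halves (univ.filter fun x => f x = k) hab (two a ha k) (two b hb k)
  have fib : ∀ C : β → Finset α, (∀ k, C k ⊆ univ.filter fun x => f x = k) →
      ∀ k, ((univ.filter fun x => x ∈ C (f x)).filter fun x => f x = k) = C k := by
    intro C hC k
    ext x
    simp only [mem_filter, mem_univ, true_and]
    refine ⟨fun h => h.2 ▸ h.1, fun h => ?_⟩
    have hx : f x = k := by simpa using hC k h
    exact ⟨hx.symm ▸ h, hx⟩
  refine ⟨univ.filter fun x => x ∈ A (f x), univ.filter fun x => x ∈ B (f x), ?_,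
    fun k => by rw [fib A hA, hAc], fun k => by rw [fib B hB, hBc],
    by simpa using haA (f a) (by simp), by simpa using hbB (f b) (by simp)⟩
  rw [disjoint_left]
  intro x hxA hxB
  simp only [mem_filter, mem_univ, true_and] at hxA hxB
  exact disjoint_left.1 (hAB _) hxA hxB

theorem invDist_eq_card_ordered {K : ℕ} (σ τ : Pref K) :
    invDist σ τ =
      (univ.filter fun p : Fin K × Fin K => σ p.1 < σ p.2 ∧ τ p.2 < τ p.1).card := by
  have tri : ∀ (ρ : Pref K) (x y : Fin K), x ≠ y → (ρ x < ρ y ∨ ρ y < ρ x) := fun ρ x y h =>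
    lt_or_gt_of_ne (ρ.injective.ne h)
  refine card_nbij' (fun p => if σ p.1 < σ p.2 then p else p.swap)
    (fun p => if p.1 < p.2 then p else p.swap) ?_ ?_ ?_ ?_
  · rintro ⟨x, y⟩ h
    simp only [coe_filter, mem_univ, true_and, Set.mem_ofPred_eq] at h ⊢
    have := tri σ x y h.1.ne
    have := tri τ x y h.1.ne
    split_ifs <;> grind
  · rintro ⟨x, y⟩ h
    simp only [coe_filter, mem_univ, true_and, Set.mem_ofPred_eq] at h ⊢
    have : x ≠ y := by rintro rfl; exact h.1.false
    split_ifs <;> grind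
  · rintro ⟨x, y⟩ h
    simp only [coe_filter, mem_univ, true_and, Set.mem_ofPred_eq] at h ⊢
    split_ifs <;> grind
  · rintro ⟨x, y⟩ h
    simp only [coe_filter, mem_univ, true_and, Set.mem_ofPred_eq] at h ⊢
    have : x ≠ y := by rintro rfl; exact h.1.false
    split_ifs <;> grind

theorem invDist_mul_right {K : ℕ} (σ τ ρ : Pref K) : invDist (σ * ρ) (τ * ρ) = invDist σ τ := by
  rw [invDist_eq_card_ordered, invDist_eq_card_ordered]
  exact card_equiv (ρ.prodCongr ρ) fun p => by simp only [mem_filter]; simp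

theorem invDist_eq_invDist_one {K : ℕ} (σ τ : Pref K) : invDist σ τ = invDist (σ * τ⁻¹) 1 := by
  rw [← invDist_mul_right σ τ τ⁻¹, mul_inv_cancel]

theorem card_filter_invDist_eq {K : ℕ} (σ₀ : Pref K) (k : ℕ) :
    (univ.filter fun σ => invDist σ σ₀ = k).card = mahonian K k := by
  refine card_equiv (Equiv.mulRight σ₀⁻¹) fun σ => ?_
  simp only [mem_filter, mem_univ, true_and, Equiv.coe_mulRight]
  rw [invDist_eq_invDist_one]
  rfl

/-- Swapping two adjacent positions at an ascent creates exactly one inversion. -/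
theorem invDist_mul_swap_succ {n : ℕ} (π : Pref (n + 1)) (i : Fin n)
    (h : π i.castSucc < π i.succ) :
    invDist (π * Equiv.swap i.castSucc i.succ) 1 = invDist π 1 + 1 := by
  set s := Equiv.swap i.castSucc i.succ with hs
  have hss : ∀ x, s (s x) = x := Equiv.swap_apply_self _ _
  have hsymm : s.symm = s := Equiv.symm_swap _ _
  have lt : ∀ x y, (x, y) ≠ (i.castSucc, i.succ) → x < y → s x < s y := by
    intro x y hne hxy
    simp only [hs, Equiv.swap_apply_def]
    simp only [ne_eq, Prod.mk.injEq, Fin.ext_iff, Fin.lt_def, Fin.val_castSucc, Fin.val_succ]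
      at hne hxy ⊢
    split_ifs <;> simp_all <;> omega
  have hlt : i.castSucc < i.succ := Fin.castSucc_lt_succ
  have hsa : s i.castSucc = i.succ := Equiv.swap_apply_left _ _
  have hsb : s i.succ = i.castSucc := Equiv.swap_apply_right _ _
  have himg : (univ.filter fun p : Fin (n + 1) × Fin (n + 1) =>
        p.1 < p.2 ∧ (((π * s) p.1 < (π * s) p.2) ↔
          ¬ (1 : Pref (n + 1)) p.1 < (1 : Pref (n + 1)) p.2)) =
      insert (i.castSucc, i.succ) ((univ.filter fun p : Fin (n + 1) × Fin (n + 1) =>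
        p.1 < p.2 ∧ ((π p.1 < π p.2) ↔
          ¬ (1 : Pref (n + 1)) p.1 < (1 : Pref (n + 1)) p.2)).map
            (s.prodCongr s).toEmbedding) := by
    ext ⟨x, y⟩
    simp only [mem_insert, mem_map_equiv, Equiv.prodCongr_symm, Equiv.prodCongr_apply, Prod.map,
      hsymm, Equiv.Perm.mul_apply, Equiv.Perm.one_apply]
    have := lt x y
    have := lt (s x) (s y)
    grind
  unfold invDist
  rw [himg, card_insert_of_notMem, card_map]
  simp only [mem_map_equiv, mem_filter, not_and]
  intro _ hlt'
  simp only [Equiv.prodCongr_symm, Equiv.prodCongr_apply, Prod.map, hsymm, hsa, hsb] at hlt'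
  exact absurd hlt' hlt.not_gt

/-- Swapping two adjacent positions at a descent removes exactly one inversion. -/
theorem invDist_mul_swap_succ_of_gt {n : ℕ} (π : Pref (n + 1)) (i : Fin n)
    (h : π i.succ < π i.castSucc) :
    invDist (π * Equiv.swap i.castSucc i.succ) 1 + 1 = invDist π 1 := by
  rw [← invDist_mul_swap_succ, Equiv.mul_swap_mul_self]
  simpa using h

theorem Equiv.Perm.eq_one_of_strictMono {n : ℕ} (π : Equiv.Perm (Fin n)) (h : StrictMono π) :
    π = 1 := by
  apply Equiv.coe_fn_injective
  exact (h.range_inj strictMono_id).1 (by simp [π.surjective.range_eq])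

/-- A permutation with both an ascent and a descent is not determined by its number of
inversions. -/
theorem exists_ne_invDist_one_eq {K : ℕ} (π : Pref K) (h1 : π ≠ 1) (hrev : π ≠ Fin.revPerm) :
    ∃ τ ≠ π, invDist τ 1 = invDist π 1 := by
  obtain _ | n := K
  · exact absurd (Subsingleton.elim _ _) h1
  obtain ⟨j, hj⟩ : ∃ j : Fin n, π j.succ < π j.castSucc := by
    by_contra! hall
    refine h1 (π.eq_one_of_strictMono (Fin.strictMono_iff_lt_succ.2 fun i => ?_))
    exact (hall i).lt_of_ne (π.injective.ne Fin.castSucc_lt_succ.ne)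
  obtain ⟨i, hi⟩ : ∃ i : Fin n, π i.castSucc < π i.succ := by
    by_contra! hall
    have : Fin.revPerm * π = 1 := by
      refine Equiv.Perm.eq_one_of_strictMono _ (Fin.strictMono_iff_lt_succ.2 fun i => ?_)
      simpa using (hall i).lt_of_ne (π.injective.ne Fin.castSucc_lt_succ.ne')
    refine hrev ?_
    rw [← inv_eq_of_mul_eq_one_right this]
    rfl
  have hij : i ≠ j := by
    rintro rfl
    exact hi.not_gt hj
  set s := Equiv.swap i.castSucc i.succ with hs
  set t := Equiv.swap j.castSucc j.succ with ht
  have hst : s ≠ t := by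
    intro h
    have h' := congrArg (fun e : Pref (n + 1) => e i.castSucc) h
    simp only [hs, ht, Equiv.swap_apply_left, Equiv.swap_apply_def] at h'
    simp only [Fin.ext_iff, Fin.val_castSucc, Fin.val_succ, apply_ite Fin.val, ne_eq] at h' hij
    split_ifs at h' <;> omega
  have hne : ∀ a b : Pref (n + 1), b * b = 1 → a ≠ b → π * a * b ≠ π := by
    intro a b hb hab h
    apply hab
    rw [mul_assoc, mul_eq_left] at h
    rw [eq_inv_of_mul_eq_one_left h, inv_eq_of_mul_eq_one_left hb]
  by_cases hA : (π * t) i.castSucc < (π * t) i.succ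
  · refine ⟨π * t * s, hne t s (Equiv.swap_mul_self _ _) hst.symm, ?_⟩
    rw [invDist_mul_swap_succ _ _ hA, invDist_mul_swap_succ_of_gt _ _ hj]
  · have hB : (π * s) j.succ < (π * s) j.castSucc := by
      by_contra hB
      simp only [Equiv.Perm.mul_apply] at hA hB
      have hij' : (i : ℕ) ≠ j := fun h => hij (Fin.ext h)
      have hinj : ∀ x y, π x = π y → (x : ℕ) = y := fun x y h => congrArg Fin.val (π.injective h)
      have h₁ := hinj j.succ i.castSucc
      have h₂ := hinj j.castSucc i.succ
      simp only [hs, ht, Equiv.swap_apply_def, Fin.ext_iff, Fin.val_castSucc, Fin.val_succ]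
        at hA hB h₁ h₂
      split_ifs at hA hB <;> omega
    refine ⟨π * s * t, hne s t (Equiv.swap_mul_self _ _) hst, ?_⟩
    have h₁ : invDist (π * s * t) 1 + 1 = invDist (π * s) 1 :=
      invDist_mul_swap_succ_of_gt _ _ hB
    have h₂ : invDist (π * s) 1 = invDist π 1 + 1 := invDist_mul_swap_succ _ _ hi
    omega

theorem exists_ne_invDist_eq {K : ℕ} (σ σ₀ : Pref K) (h : σ ≠ σ₀ ∧ σ ≠ revPref σ₀) :
    ∃ τ ≠ σ, invDist τ σ₀ = invDist σ σ₀ := by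
  obtain ⟨τ, hne, hτ⟩ := exists_ne_invDist_one_eq (σ * σ₀⁻¹)
    (fun h' => h.1 (mul_inv_eq_one.1 h')) (fun h' => h.2 (mul_inv_eq_iff_eq_mul.1 h'))
  refine ⟨τ * σ₀, fun h' => hne (eq_mul_inv_of_mul_eq h'), ?_⟩
  rw [invDist_eq_invDist_one, invDist_eq_invDist_one σ, mul_inv_cancel_right, hτ]

/-- any two distinct preference relations other than `≻₀` and its
reverse lie in opposite halves of some `(K!/2 - c)`-balanced pair. -/
theorem stmt2 (K : ℕ) (hK : 2 < K) (σ₀ : Pref K)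
    (c : ℕ) (hc : c = oddMahonianCount K / 2)
    (σ₁ σ₂ : Pref K) (h₁ : σ₁ ≠ σ₀ ∧ σ₁ ≠ revPref σ₀)
    (h₂ : σ₂ ≠ σ₀ ∧ σ₂ ≠ revPref σ₀) (hne : σ₁ ≠ σ₂) :
    ∃ C₁ C₂ : Finset (Pref K),
      BalancedPair σ₀ (K.factorial / 2 - c) C₁ C₂ ∧ σ₁ ∈ C₁ ∧ σ₂ ∈ C₂ := by
  obtain ⟨A, B, hAB, hA, hB, h₁A, h₂B⟩ := exists_disjoint_fiberwise_halves
    (fun σ => invDist σ σ₀) hne (exists_ne_invDist_eq σ₁ σ₀ h₁) (exists_ne_invDist_eq σ₂ σ₀ h₂)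
  have htotal := card_eq_two_mul_sum_card_fiber_half fun σ : Pref K => invDist σ σ₀
  have hodd : {k | Odd (univ.filter fun σ : Pref K => invDist σ σ₀ = k).card}.ncard =
      oddMahonianCount K := by
    simp only [card_filter_invDist_eq, oddMahonianCount]
  rw [hodd, Fintype.card_perm, Fintype.card_fin] at htotal
  have hcard : ∀ C : Finset (Pref K),
      (∀ k, (C.filter fun σ => invDist σ σ₀ = k).card =
        (univ.filter fun σ => invDist σ σ₀ = k).card / 2) → C.card = K.factorial / 2 - c := by
    intro C hC
    rw [card_eq_sum_card_fiberwise (f := fun σ => invDist σ σ₀)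
      (t := univ.image fun σ => invDist σ σ₀) (fun σ _ => by simp), sum_congr rfl fun k _ => hC k]
    omega
  exact ⟨A, B, ⟨hAB, hcard A hA, hcard B hB, fun k _ => (hA k).trans (hB k).symm⟩, h₁A, h₂B⟩
end
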